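/- arXiv:2605.27098 — 5 statements merged into one kernel-verified Lean document; each statement's English description precedes it below -/
import Mathlib

section
/- The probability mass function η on (ZMod 3)^4 is pairwise independent: for every pair of distinct coordinate indices k1 ≠ k2 in {1,2,3,4} and every pair of values j1, j2 ∈ ZMod 3, the probability under η that the k1-th coordinate equals j1 and the k2-th coordinate equals j2 is exactly 1/9. Equivalently, there is exactly one pair (a,b) ∈ (ZMod 3)^2 such that the k1-th coordinate of (a, b, a+b, a+2b) equals j1 and its k2-th coordinate equals j2. -/
/-- The distribution η on `(ZMod 3)^4`: uniform over tuples `(a, b, a+b, a+2b)`. -/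
noncomputable def eta (w : Fin 4 → ZMod 3) : ℝ :=
  if ∃ a b : ZMod 3, w = ![a, b, a + b, a + 2 * b] then 1 / 9 else 0

/-- Every expectation under `eta` is the average over the nine parameters `(a, b)`. -/
theorem sum_eta_mul (f : (Fin 4 → ZMod 3) → ℝ) :
    ∑ w, eta w * f w =
      ∑ ab : ZMod 3 × ZMod 3, 1 / 9 * f ![ab.1, ab.2, ab.1 + ab.2, ab.1 + 2 * ab.2] := by
  classical
  symm
  refine Finset.sum_of_injOn
    (fun ab : ZMod 3 × ZMod 3 => ![ab.1, ab.2, ab.1 + ab.2, ab.1 + 2 * ab.2]) ?_ (by simp) ?_ ?_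
  · rintro ⟨a, b⟩ - ⟨c, d⟩ - h
    exact Prod.ext (congrFun h 0) (congrFun h 1)
  · intro w _ hw
    have hne : ¬∃ a b : ZMod 3, w = ![a, b, a + b, a + 2 * b] := by
      rintro ⟨a, b, rfl⟩
      exact hw ⟨(a, b), by simp, rfl⟩
    rw [eta, if_neg hne, zero_mul]
  · rintro ⟨a, b⟩ -
    rw [eta, if_pos ⟨a, b, rfl⟩]

/-- Any two distinct coordinates of `(a, b, a+b, a+2b)` determine `(a, b)`. -/
theorem card_filter_coords_eq_one : ∀ k1 k2 : Fin 4, k1 ≠ k2 → ∀ j1 j2 : ZMod 3,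
    (Finset.univ.filter (fun ab : ZMod 3 × ZMod 3 =>
      (![ab.1, ab.2, ab.1 + ab.2, ab.1 + 2 * ab.2] : Fin 4 → ZMod 3) k1 = j1 ∧
      (![ab.1, ab.2, ab.1 + ab.2, ab.1 + 2 * ab.2] : Fin 4 → ZMod 3) k2 = j2)).card = 1 := by
  decide

/-- η is pairwise independent: any two distinct coordinates are jointly uniform on
`(ZMod 3)^2`; equivalently, for distinct coordinates `k1 ≠ k2` and values `j1, j2`,
exactly one pair `(a,b)` has the `k1`-th coordinate of `(a, b, a+b, a+2b)` equal to
`j1` and the `k2`-th coordinate equal to `j2`. -/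
theorem eta_pairwise_independent :
    (∀ (k1 k2 : Fin 4), k1 ≠ k2 → ∀ (j1 j2 : ZMod 3),
      ∑ w : Fin 4 → ZMod 3, eta w * (if w k1 = j1 ∧ w k2 = j2 then 1 else 0) = 1 / 9) ∧
    (∀ (k1 k2 : Fin 4), k1 ≠ k2 → ∀ (j1 j2 : ZMod 3),
      (Finset.univ.filter (fun ab : ZMod 3 × ZMod 3 =>
        (![ab.1, ab.2, ab.1 + ab.2, ab.1 + 2 * ab.2] : Fin 4 → ZMod 3) k1 = j1 ∧
        (![ab.1, ab.2, ab.1 + ab.2, ab.1 + 2 * ab.2] : Fin 4 → ZMod 3) k2 = j2)).card = 1) := by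
  refine ⟨fun k1 k2 hk j1 j2 => ?_, card_filter_coords_eq_one⟩
  rw [sum_eta_mul (fun w => if w k1 = j1 ∧ w k2 = j2 then 1 else 0), ← Finset.mul_sum,
    Finset.sum_boole, card_filter_coords_eq_one k1 k2 hk j1 j2, Nat.cast_one, mul_one]
end

section
/- For every ε ∈ (0,1), the probability mass function η'_ε on (ZMod 3)^4 is balanced and pairwise independent: for every coordinate index k ∈ {1,2,3,4} and value j ∈ ZMod 3, the probability under η'_ε that the k-th coordinate equals j is 1/3; and for every pair of distinct coordinate indices k1 ≠ k2 and values j1, j2 ∈ ZMod 3, the probability under η'_ε that the k1-th coordinate equals j1 and the k2-th coordinate equals j2 is 1/9. -/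
/-- The noisy distribution `η'_ε = (1-ε)·η + ε·uniform` on `(ZMod 3)^4`. -/
noncomputable def etaP (ε : ℝ) (w : Fin 4 → ZMod 3) : ℝ :=
  (1 - ε) * eta w + ε * (1 / 81)

theorem exists_eq_codeword_iff (w : Fin 4 → ZMod 3) :
    (∃ a b : ZMod 3, w = ![a, b, a + b, a + 2 * b]) ↔
      w 2 = w 0 + w 1 ∧ w 3 = w 0 + 2 * w 1 := by
  constructor
  · rintro ⟨a, b, rfl⟩
    exact ⟨rfl, rfl⟩
  · rintro ⟨h2, h3⟩
    refine ⟨w 0, w 1, ?_⟩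
    ext i
    fin_cases i <;> simp [h2, h3]

/-- The probability of an event under `η'_ε`, in terms of the number of codewords and the number
of words it contains. -/
theorem sum_etaP_mul_ite (ε : ℝ) (p : (Fin 4 → ZMod 3) → Prop) [DecidablePred p] :
    ∑ w : Fin 4 → ZMod 3, etaP ε w * (if p w then 1 else 0) =
      (1 - ε) * ((Finset.univ.filter fun w : Fin 4 → ZMod 3 =>
        (w 2 = w 0 + w 1 ∧ w 3 = w 0 + 2 * w 1) ∧ p w).card / 9) +
      ε * ((Finset.univ.filter p).card / 81) := by
  simp only [Finset.card_filter, Nat.cast_sum, Finset.sum_div, Finset.mul_sum,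
    ← Finset.sum_add_distrib]
  refine Finset.sum_congr rfl fun w _ => ?_
  simp only [etaP, eta, exists_eq_codeword_iff]
  by_cases hc : w 2 = w 0 + w 1 ∧ w 3 = w 0 + 2 * w 1 <;> by_cases hp : p w <;> simp [hc, hp]

theorem card_codewords_apply_eq (k : Fin 4) (j : ZMod 3) :
    (Finset.univ.filter fun w : Fin 4 → ZMod 3 =>
      (w 2 = w 0 + w 1 ∧ w 3 = w 0 + 2 * w 1) ∧ w k = j).card = 3 := by
  revert k j
  decide +kernel

theorem card_words_apply_eq (k : Fin 4) (j : ZMod 3) :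
    (Finset.univ.filter fun w : Fin 4 → ZMod 3 => w k = j).card = 27 := by
  revert k j
  decide +kernel

theorem card_codewords_apply_eq_and_apply_eq {k1 k2 : Fin 4} (h : k1 ≠ k2) (j1 j2 : ZMod 3) :
    (Finset.univ.filter fun w : Fin 4 → ZMod 3 =>
      (w 2 = w 0 + w 1 ∧ w 3 = w 0 + 2 * w 1) ∧ w k1 = j1 ∧ w k2 = j2).card = 1 := by
  revert k1 k2 j1 j2
  decide +kernel

theorem card_words_apply_eq_and_apply_eq {k1 k2 : Fin 4} (h : k1 ≠ k2) (j1 j2 : ZMod 3) :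
    (Finset.univ.filter fun w : Fin 4 → ZMod 3 => w k1 = j1 ∧ w k2 = j2).card = 9 := by
  revert k1 k2 j1 j2
  decide +kernel

/-- For every `ε ∈ (0,1)`, `η'_ε` is balanced and pairwise independent. -/
theorem etaP_balanced_pairwise_independent (ε : ℝ) (hε0 : 0 < ε) (hε1 : ε < 1) :
    (∀ (k : Fin 4) (j : ZMod 3),
      ∑ w : Fin 4 → ZMod 3, etaP ε w * (if w k = j then 1 else 0) = 1 / 3) ∧
    (∀ (k1 k2 : Fin 4), k1 ≠ k2 → ∀ (j1 j2 : ZMod 3),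
      ∑ w : Fin 4 → ZMod 3, etaP ε w * (if w k1 = j1 ∧ w k2 = j2 then 1 else 0) = 1 / 9) := by
  refine ⟨fun k j => ?_, fun k1 k2 h j1 j2 => ?_⟩
  · rw [sum_etaP_mul_ite ε fun w => w k = j, card_codewords_apply_eq, card_words_apply_eq]
    push_cast
    ring
  · rw [sum_etaP_mul_ite ε fun w => w k1 = j1 ∧ w k2 = j2,
      card_codewords_apply_eq_and_apply_eq h, card_words_apply_eq_and_apply_eq h]
    push_cast
    ring
end

section
/- (Completeness of the dictator test.) Fix ε ∈ (0,1), a positive integer R, and a coordinate i ∈ {1,…,R}. Then for every z ∈ (ZMod 3)^R with z_i = 0: Σ_{(x^1,x^2,x^3,x^4)} p_ε(x^1,x^2,x^3,x^4) · Σ_{t=1}^{4} 1{χ(x^1_i, x^2_i, x^3_i, x^4_i) = t and x^t = z} ≥ (1 − ε)/3^{R-1}. In words, if each 4-tuple of points (a 'small good') is allocated to its t-th component where t = χ applied to the i-th coordinates (whenever χ > 0), then every agent z with z_i = 0 receives total p_ε-mass at least (1 − ε)/3^{R-1}. -/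
/-- The product distribution `p_ε` on tuples of four points of `(ZMod 3)^R`. -/
noncomputable def pdist (ε : ℝ) (R : ℕ) (x : Fin 4 → Fin R → ZMod 3) : ℝ :=
  ∏ i : Fin R, etaP ε (fun t => x t i)

/-- `χ(w)` is the smallest index `j ∈ {1,2,3,4}` with `w_j = 0`, or `0` if none. -/
def chi (w : Fin 4 → ZMod 3) : ℕ :=
  if w 0 = 0 then 1 else if w 1 = 0 then 2 else if w 2 = 0 then 3
    else if w 3 = 0 then 4 else 0

/-- The tuple `(a, b, a+b, a+2b)` determined by `(a, b)`. -/
def linePoint (p : ZMod 3 × ZMod 3) : Fin 4 → ZMod 3 :=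
  ![p.1, p.2, p.1 + p.2, p.1 + 2 * p.2]

theorem linePoint_injective : Function.Injective linePoint := by
  intro p q h
  exact Prod.ext (congrFun h 0) (congrFun h 1)

theorem sum_eta_mul_s8 (g : (Fin 4 → ZMod 3) → ℝ) :
    ∑ w, eta w * g w = 1 / 9 * ∑ p, g (linePoint p) := by
  have h : ∀ w, w ∉ Set.range linePoint → eta w * g w = 0 := by
    intro w hw
    rw [eta, if_neg, zero_mul]
    rintro ⟨a, b, rfl⟩
    exact hw ⟨(a, b), rfl⟩
  rw [Finset.mul_sum]
  refine (Fintype.sum_of_injective linePoint linePoint_injective _ _ h fun p => ?_).symm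
  rw [eta, if_pos ⟨p.1, p.2, rfl⟩]

theorem sum_etaP_mul (ε : ℝ) (g : (Fin 4 → ZMod 3) → ℝ) :
    ∑ w, etaP ε w * g w =
      (1 - ε) * (1 / 9 * ∑ p, g (linePoint p)) + ε * (1 / 81 * ∑ w, g w) := by
  simp only [etaP, add_mul, mul_assoc, Finset.sum_add_distrib, ← Finset.mul_sum, sum_eta_mul_s8]

/-- Every one-coordinate marginal of `etaP ε` is uniform. -/
theorem sum_etaP_mul_coord (ε : ℝ) (t : Fin 4) (c : ZMod 3) :
    ∑ w, etaP ε w * (if w t = c then 1 else 0) = 1 / 3 := by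
  have h₁ : ∀ (t : Fin 4) (c : ZMod 3),
      (Finset.univ.filter fun p => linePoint p t = c).card = 3 := by
    decide
  have h₂ : (Finset.univ.filter fun w : Fin 4 → ZMod 3 => w t = c).card = 27 := by
    simpa using Fintype.card_filter_piFinset_const (Finset.univ : Finset (ZMod 3)) t c
  rw [sum_etaP_mul, Finset.sum_boole, Finset.sum_boole, h₁, h₂]
  push_cast
  ring

theorem sum_chi_indicator (w : Fin 4 → ZMod 3) :
    (∑ t : Fin 4, if chi w = (t : ℕ) + 1 ∧ w t = 0 then (1 : ℝ) else 0) =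
      if chi w = 0 then 0 else 1 := by
  simp only [Fin.sum_univ_four, chi]
  by_cases h₀ : w 0 = 0 <;> by_cases h₁ : w 1 = 0 <;> by_cases h₂ : w 2 = 0 <;>
    by_cases h₃ : w 3 = 0 <;> simp [h₀, h₁, h₂, h₃]

theorem chi_linePoint_ne_zero (p : ZMod 3 × ZMod 3) : chi (linePoint p) ≠ 0 := by
  revert p
  decide

theorem le_sum_etaP_mul_chi (ε : ℝ) (hε : 0 ≤ ε) :
    1 - ε ≤ ∑ w, etaP ε w * (if chi w = 0 then 0 else 1) := by
  rw [sum_etaP_mul]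
  simp only [chi_linePoint_ne_zero, if_false, Finset.sum_const, Finset.card_univ,
    Fintype.card_prod, ZMod.card]
  have : 0 ≤ ε * (1 / 81 * ∑ w : Fin 4 → ZMod 3, if chi w = 0 then (0 : ℝ) else 1) := by
    positivity
  norm_num at this ⊢
  linarith

/-- Expectations of coordinatewise products factor under `pdist`. -/
theorem sum_pdist_mul_prod (ε : ℝ) (R : ℕ) (g : Fin R → (Fin 4 → ZMod 3) → ℝ) :
    ∑ x, pdist ε R x * ∏ j, g j (fun s => x s j) = ∏ j, ∑ w, etaP ε w * g j w := by
  simp only [pdist, ← Finset.prod_mul_distrib]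
  rw [Finset.prod_univ_sum, Fintype.piFinset_univ]
  exact Equiv.sum_comp (Equiv.piComm fun (_ : Fin 4) (_ : Fin R) => ZMod 3)
    fun y => ∏ j, etaP ε (y j) * g j (y j)

theorem sum_pdist_mul_indicator (ε : ℝ) (R : ℕ) (i : Fin R) (z : Fin R → ZMod 3)
    (t : Fin 4) (P : (Fin 4 → ZMod 3) → Prop) [DecidablePred P] :
    ∑ x, pdist ε R x * (if P (fun s => x s i) ∧ x t = z then 1 else 0) =
      (∑ w, etaP ε w * (if P w ∧ w t = z i then 1 else 0)) * (1 / 3) ^ (R - 1) := by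
  have h (x : Fin 4 → Fin R → ZMod 3) :
      (if P (fun s => x s i) ∧ x t = z then (1 : ℝ) else 0) =
        ∏ j, if (j = i → P fun s => x s j) ∧ x t j = z j then 1 else 0 := by
    rw [Finset.prod_boole]
    congr 1
    simp [forall_and, funext_iff]
  simp only [h]
  rw [sum_pdist_mul_prod ε R fun j w => if (j = i → P w) ∧ w t = z j then 1 else 0,
    ← Finset.mul_prod_erase _ _ (Finset.mem_univ i)]
  congr 1
  · simp
  · rw [Finset.prod_congr rfl (g := fun _ => (1 / 3 : ℝ))]
    · simp
    · intro j hj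
      simp only [Finset.ne_of_mem_erase hj, false_imp_iff, true_and]
      exact sum_etaP_mul_coord ε t (z j)

/-- Completeness of the dictator test: if each small good `(x^1,x^2,x^3,x^4)` is
allocated to its `t`-th component where `t = χ(x^1_i,…,x^4_i)` (whenever `χ > 0`,
identifying `t : Fin 4` with the χ-value `t+1`), then every agent `z` with `z_i = 0`
receives total `p_ε`-mass at least `(1-ε)/3^(R-1)`. -/
theorem dictator_test_completeness (ε : ℝ) (hε0 : 0 < ε) (hε1 : ε < 1)
    (R : ℕ) (hR : 0 < R) (i : Fin R) (z : Fin R → ZMod 3) (hz : z i = 0) :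
    ∑ x : Fin 4 → Fin R → ZMod 3,
      pdist ε R x *
        (∑ t : Fin 4,
          if chi (fun s => x s i) = (t : ℕ) + 1 ∧ x t = z then 1 else 0)
    ≥ (1 - ε) / 3 ^ (R - 1) := by
  have hsum := le_sum_etaP_mul_chi ε hε0.le
  simp only [← sum_chi_indicator, Finset.mul_sum] at hsum
  rw [Finset.sum_comm] at hsum
  simp only [Finset.mul_sum]
  rw [Finset.sum_comm]
  have h (t : Fin 4) := sum_pdist_mul_indicator ε R i z t fun w => chi w = (t : ℕ) + 1
  simp only [h, hz]
  rw [← Finset.sum_mul, ge_iff_le, div_eq_mul_inv, one_div, inv_pow]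
  exact mul_le_mul_of_nonneg_right hsum (by positivity)
end

section
/- (Soundness of the dictator test, conditional on the invariance-type inequality.) Fix ε ∈ (0,1) and a positive integer R. Let f : (ZMod 3)^R → {0,1} be a function such that exactly 2·3^{R-1} points x satisfy f(x) = 1 (i.e., the average of f over (ZMod 3)^R equals 2/3). Suppose moreover that | Σ_{(x^1,x^2,x^3,x^4)} p_ε(x^1,x^2,x^3,x^4)·f(x^1)f(x^2)f(x^3)f(x^4) − ∏_{t=1}^{4} ( Σ_{(x^1,x^2,x^3,x^4)} p_ε(x^1,x^2,x^3,x^4)·f(x^t) ) | ≤ ε. Then 1 − Σ_{(x^1,x^2,x^3,x^4)} p_ε(x^1,x^2,x^3,x^4)·f(x^1)f(x^2)f(x^3)f(x^4) ≤ 65/81 + ε. -/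
theorem sum_eta_fiber (t : Fin 4) (c : ZMod 3) :
    ∑ w : Fin 4 → ZMod 3, (if w t = c then eta w else 0) = 1 / 3 := by
  have hcount : ∀ (t : Fin 4) (c : ZMod 3),
      (Finset.univ.filter (fun w : Fin 4 → ZMod 3 => w t = c ∧
        ∃ a b : ZMod 3, w = ![a, b, a + b, a + 2 * b])).card = 3 := by
    decide
  simp only [eta, ← ite_and]
  rw [← Finset.sum_filter, Finset.sum_const, hcount]
  norm_num

theorem sum_etaP_fiber (ε : ℝ) (t : Fin 4) (c : ZMod 3) :
    ∑ w : Fin 4 → ZMod 3, (if w t = c then etaP ε w else 0) = 1 / 3 := by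
  have hcount : ∀ (t : Fin 4) (c : ZMod 3),
      (Finset.univ.filter (fun w : Fin 4 → ZMod 3 => w t = c)).card = 27 := by
    decide
  have hη := sum_eta_fiber t c
  rw [← Finset.sum_filter] at hη ⊢
  simp only [etaP]
  rw [Finset.sum_add_distrib, ← Finset.mul_sum, hη, Finset.sum_const, hcount]
  norm_num
  ring

/-- Each of the four marginals of `pdist ε R` is uniform on `(ZMod 3)^R`. -/
theorem sum_pdist_fiber (ε : ℝ) (R : ℕ) (t : Fin 4) (y : Fin R → ZMod 3) :
    ∑ x : Fin 4 → Fin R → ZMod 3, (if x t = y then pdist ε R x else 0) = (1 / 3) ^ R := by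
  calc ∑ x : Fin 4 → Fin R → ZMod 3, (if x t = y then pdist ε R x else 0)
      = ∑ x : Fin 4 → Fin R → ZMod 3,
          ∏ i, (if x t i = y i then etaP ε (fun s => x s i) else 0) := by
        refine Finset.sum_congr rfl fun x _ => ?_
        rw [Finset.prod_ite_zero]
        simp only [funext_iff, Finset.mem_univ, true_imp_iff, pdist]
    _ = ∑ z : Fin R → Fin 4 → ZMod 3, ∏ i, (if z i t = y i then etaP ε (z i) else 0) :=
        Fintype.sum_equiv (Equiv.piComm _) _ _ fun _ => rfl
    _ = ∏ i, ∑ w : Fin 4 → ZMod 3, (if w t = y i then etaP ε w else 0) := by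
        rw [Finset.prod_univ_sum, Fintype.piFinset_univ]
    _ = (1 / 3) ^ R := by simp [sum_etaP_fiber]

theorem sum_pdist_mul_apply (ε : ℝ) (R : ℕ) (f : (Fin R → ZMod 3) → ℝ) (t : Fin 4) :
    ∑ x : Fin 4 → Fin R → ZMod 3, pdist ε R x * f (x t) = (1 / 3) ^ R * ∑ y, f y := by
  calc ∑ x : Fin 4 → Fin R → ZMod 3, pdist ε R x * f (x t)
      = ∑ x : Fin 4 → Fin R → ZMod 3, ∑ y, (if x t = y then pdist ε R x else 0) * f y := by
        simp
    _ = (1 / 3) ^ R * ∑ y, f y := by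
        rw [Finset.sum_comm, Finset.mul_sum]
        simp only [← Finset.sum_mul, sum_pdist_fiber]

open scoped Classical in
/-- Soundness of the dictator test, conditional on the invariance-type inequality:
if `f` is 0/1-valued with exactly `2·3^(R-1)` ones, and the `p_ε`-expectation of the
product `f(x^1)f(x^2)f(x^3)f(x^4)` is `ε`-close to the product of the marginal
expectations, then `1` minus that expectation is at most `65/81 + ε`. -/
theorem dictator_test_soundness (ε : ℝ) (hε0 : 0 < ε) (hε1 : ε < 1)
    (R : ℕ) (hR : 0 < R)
    (f : (Fin R → ZMod 3) → ℝ) (hf : ∀ y, f y = 0 ∨ f y = 1)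
    (hcard : (Finset.univ.filter (fun y : Fin R → ZMod 3 => f y = 1)).card
      = 2 * 3 ^ (R - 1))
    (hinv : |(∑ x : Fin 4 → Fin R → ZMod 3,
          pdist ε R x * (f (x 0) * f (x 1) * f (x 2) * f (x 3)))
        - ∏ t : Fin 4, ∑ x : Fin 4 → Fin R → ZMod 3, pdist ε R x * f (x t)| ≤ ε) :
    1 - ∑ x : Fin 4 → Fin R → ZMod 3,
        pdist ε R x * (f (x 0) * f (x 1) * f (x 2) * f (x 3))
      ≤ 65 / 81 + ε := by
  have hsum : ∑ y, f y = 2 * 3 ^ (R - 1) := by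
    have hind : ∀ y, f y = if f y = 1 then 1 else 0 := fun y => by
      rcases hf y with h | h <;> simp [h]
    rw [Finset.sum_congr rfl fun y _ => hind y, Finset.sum_boole, hcard]
    norm_num
  have hmean : ∀ t : Fin 4,
      ∑ x : Fin 4 → Fin R → ZMod 3, pdist ε R x * f (x t) = 2 / 3 := fun t => by
    obtain ⟨n, rfl⟩ : ∃ n, R = n + 1 := ⟨R - 1, by omega⟩
    rw [sum_pdist_mul_apply, hsum, Nat.add_sub_cancel, pow_succ, one_div, inv_pow]
    field_simp
  simp only [hmean, Finset.prod_const, Finset.card_univ, Fintype.card_fin] at hinv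
  have hlow := (abs_le.mp hinv).1
  norm_num at hlow
  linarith
end

section
/- (Random-labeling lemma underlying the good-vertex claim.) Let A and B be nonempty finite sets and E ⊆ A × B the edge relation of a bipartite graph in which every b ∈ B has exactly δ_B ≥ 1 neighbors in A. Let R be a positive integer and for each edge (a,b) ∈ E let π_{b,a} : Fin R → Fin R be a permutation. Let ε, τ > 0 be reals and d ≥ 1 an integer. Suppose: (i) there is a subset B' ⊆ B with |B'| ≥ ε|B|; (ii) each b ∈ B' has a designated label i(b) ∈ Fin R; (iii) each a ∈ A has a candidate set Cand(a) ⊆ Fin R with |Cand(a)| ≤ 2d/τ; and (iv) for every b ∈ B', at least (τ/2)·δ_B of the neighbors a of b satisfy π_{b,a}(i(b)) ∈ Cand(a). Then there exists a labeling Λ : A ∪ B → Fin R such that the number of edges (a,b) ∈ E with Λ(a) = π_{b,a}(Λ(b)) is at least (ε·τ²/(4d))·|E|. -/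
/-- Pigeonhole: some single value `r` is taken at least as often as the average over `T`. -/
theorem exists_card_filter_mem_le_mul_card_filter_eq {α β : Type*} [DecidableEq β] [Fintype β]
    [Nonempty β] (s : Finset α) (f : α → β) (T : Finset β) :
    ∃ r, (s.filter (fun x => f x ∈ T)).card ≤ T.card * (s.filter (fun x => f x = r)).card := by
  obtain ⟨r, -, hr⟩ := Finset.exists_max_image (Finset.univ : Finset β)
    (fun r => (s.filter (fun x => f x = r)).card) Finset.univ_nonempty
  refine ⟨r, Finset.card_le_mul_card_image_of_maps_to (fun x hx => (Finset.mem_filter.1 hx).2) _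
    (fun t _ => le_trans (Finset.card_le_card ?_) (hr t (Finset.mem_univ t))) |>.trans_eq
      (mul_comm _ _)⟩
  exact Finset.filter_subset_filter _ (Finset.filter_subset _ _)

/-- Counting a relation on a product by fibers over the first factor. -/
theorem card_filter_prod_eq_sum_left {A B : Type*} [Fintype A] [Fintype B]
    (P : A → B → Prop) [∀ a b, Decidable (P a b)] :
    (Finset.univ.filter (fun p : A × B => P p.1 p.2)).card =
      ∑ a, (Finset.univ.filter (fun b => P a b)).card := by
  simp only [Finset.card_filter, Fintype.sum_prod_type]

/-- Counting a relation on a product by fibers over the second factor. -/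
theorem card_filter_prod_eq_sum_right {A B : Type*} [Fintype A] [Fintype B]
    (P : A → B → Prop) [∀ a b, Decidable (P a b)] :
    (Finset.univ.filter (fun p : A × B => P p.1 p.2)).card =
      ∑ b, (Finset.univ.filter (fun a => P a b)).card := by
  simp only [Finset.card_filter, Fintype.sum_prod_type_right]


/-- Random-labeling lemma: in a bipartite graph where every `b ∈ B` has exactly
`δ_B ≥ 1` neighbors, if at least an `ε`-fraction of `B` is "good" (each good `b`
carrying a label `i(b)` such that at least a `τ/2`-fraction of its neighbors `a`
have `π b a (i b)` in a candidate set `Cand a` of size at most `2d/τ`), then some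
labeling satisfies at least an `ε·τ²/(4d)`-fraction of the edges. -/
theorem random_labeling {A B : Type*} [Fintype A] [Fintype B] [Nonempty A] [Nonempty B]
    (E : A → B → Prop) [∀ a b, Decidable (E a b)]
    (δB : ℕ) (hδB : 1 ≤ δB)
    (hB : ∀ b : B, (Finset.univ.filter (fun a : A => E a b)).card = δB)
    (R : ℕ) (hR : 0 < R)
    (π : B → A → Equiv.Perm (Fin R))
    (ε τ : ℝ) (hε : 0 < ε) (hτ : 0 < τ) (d : ℕ) (hd : 1 ≤ d)
    (B' : Finset B) (hB' : (ε : ℝ) * (Fintype.card B : ℝ) ≤ (B'.card : ℝ))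
    (lab : B → Fin R)
    (Cand : A → Finset (Fin R))
    (hCand : ∀ a : A, ((Cand a).card : ℝ) ≤ 2 * d / τ)
    (hgood : ∀ b ∈ B',
      (τ / 2) * (δB : ℝ) ≤
        ((Finset.univ.filter (fun a : A => E a b ∧ π b a (lab b) ∈ Cand a)).card : ℝ)) :
    ∃ (ΛA : A → Fin R) (ΛB : B → Fin R),
      (ε * τ ^ 2 / (4 * d)) *
          ((Finset.univ.filter (fun p : A × B => E p.1 p.2)).card : ℝ)
        ≤ ((Finset.univ.filter (fun p : A × B =>
            E p.1 p.2 ∧ ΛA p.1 = π p.2 p.1 (ΛB p.2))).card : ℝ) := by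
  classical
  have : Nonempty (Fin R) := ⟨⟨0, hR⟩⟩
  have hd0 : (0 : ℝ) < d := by exact_mod_cast hd
  choose ΛA hΛA using fun a => exists_card_filter_mem_le_mul_card_filter_eq
    (B'.filter (fun b => E a b)) (fun b => π b a (lab b)) (Cand a)
  refine ⟨ΛA, lab, ?_⟩
  set S : A → ℕ := fun a =>
    (Finset.univ.filter (fun b => E a b ∧ ΛA a = π b a (lab b))).card
  set g : A → ℕ := fun a =>
    (Finset.univ.filter (fun b => b ∈ B' ∧ E a b ∧ π b a (lab b) ∈ Cand a)).card
  have hgS (a : A) : (g a : ℝ) ≤ 2 * d / τ * S a := by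
    have h : g a ≤ (Cand a).card * S a := by
      refine le_trans (le_of_eq ?_) ((hΛA a).trans (Nat.mul_le_mul_left _
        (Finset.card_le_card fun b => ?_)))
      · refine congrArg Finset.card (Finset.ext fun b => ?_)
        simp [and_assoc]
      · simp only [Finset.mem_filter, Finset.mem_univ, true_and]
        exact fun h => ⟨h.1.2, h.2.symm⟩
    calc (g a : ℝ) ≤ (Cand a).card * S a := by exact_mod_cast h
      _ ≤ 2 * d / τ * S a := by gcongr; exact hCand a
  have hg : (B'.card : ℝ) * (τ / 2 * δB) ≤ ∑ a, (g a : ℝ) := by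
    rw [← Nat.cast_sum, ← card_filter_prod_eq_sum_left
      (fun a b => b ∈ B' ∧ E a b ∧ π b a (lab b) ∈ Cand a), card_filter_prod_eq_sum_right
      (fun a b => b ∈ B' ∧ E a b ∧ π b a (lab b) ∈ Cand a), Nat.cast_sum, ← nsmul_eq_mul]
    refine (Finset.card_nsmul_le_sum B' _ _ fun b hb => ?_).trans
      (Finset.sum_le_univ_sum_of_nonneg fun b => Nat.cast_nonneg _)
    simpa [hb] using hgood b hb
  rw [card_filter_prod_eq_sum_right, card_filter_prod_eq_sum_left
    (fun a b => E a b ∧ ΛA a = π b a (lab b))]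
  simp only [hB, Finset.sum_const, Finset.card_univ, smul_eq_mul, Nat.cast_mul, Nat.cast_sum]
  have hsum : (∑ a, (g a : ℝ)) ≤ 2 * d / τ * ∑ a, (S a : ℝ) := by
    rw [Finset.mul_sum]
    exact Finset.sum_le_sum fun a _ => hgS a
  calc ε * τ ^ 2 / (4 * d) * (Fintype.card B * δB)
      = τ / (2 * d) * (ε * Fintype.card B * (τ / 2 * δB)) := by field_simp; ring
    _ ≤ τ / (2 * d) * (2 * d / τ * ∑ a, (S a : ℝ)) := by
      refine mul_le_mul_of_nonneg_left ?_ (by positivity)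
      exact (mul_le_mul_of_nonneg_right hB' (by positivity)).trans (hg.trans hsum)
    _ = ∑ a, (S a : ℝ) := by field_simp
end
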